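/- Let 0 ≤ j ≤ n ≤ m be integers with n−j ≤ m−n. Let ≤₁ᵀ be a linear order on Λ_{j,n} refining the Bruhat order and ≤₂ᵀ a linear order on Λ_{n−j,m−n} refining the Bruhat order, and order pairs lexicographically: (λ,μ) <ᵀ (λ',μ') iff λ <₁ᵀ λ', or λ = λ' and μ <₂ᵀ μ'. Let λ, η₁ ∈ Λ_{j,n} and μ, η₂ ∈ Λ_{n−j,m−n} satisfy (w_{η₁}, w_{η₂}) >ᵀ (λ, μ) >ᵀ (η₁, η₂). If there exist ν₁ ∈ Λ_{j,n} such that the circle diagram \underline{λ}ν₁\overline{η₁} is oriented and ν₂ ∈ Λ_{n−j,m−n} such that \underline{μ}ν₂\overline{η₂} is oriented, then there exists a pair (λ', μ') >ᵀ (λ, μ) such that both \underline{λ}λ'\overline{η₁} and \underline{μ}μ'\overline{η₂} are oriented circle diagrams. -/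

import Mathlib

open scoped Classical

namespace ArcAlgebra

variable {m : ℕ}

/-- `l : Fin m → Bool` is a weight of type `(n, m)`: positions are `0`-based (position
`a : Fin m` corresponds to the 1-based position `a.val + 1`), the value `true` stands for
`∨` and `false` for `∧`, and `l` takes the value `∨` exactly `n` times. -/
def IsWeight (n : ℕ) (l : Fin m → Bool) : Prop :=
  (Finset.univ.filter (fun a => l a = true)).card = n

/-- The number of `∨`'s strictly between `c` and `c'` equals the number of `∧`'s strictly
between `c` and `c'`. -/
def Balanced (l : Fin m → Bool) (c c' : Fin m) : Prop :=
  (Finset.univ.filter (fun x => c < x ∧ x < c' ∧ l x = true)).card =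
    (Finset.univ.filter (fun x => c < x ∧ x < c' ∧ l x = false)).card

/-- `Matches l c c'` says `c` is a good point of `l` with partner `c^∧ = c'`: one has
`l c = ∨`, `c < c'`, `l c' = ∧`, the counts of `∨`'s and `∧`'s strictly between `c` and
`c'` balance, and `c'` is minimal with these properties. -/
def Matches (l : Fin m → Bool) (c c' : Fin m) : Prop :=
  l c = true ∧ c < c' ∧ l c' = false ∧ Balanced l c c' ∧
    ∀ d : Fin m, c < d → l d = false → Balanced l c d → c' ≤ d

/-- `c` is a good point of `l`. -/
def IsGood (l : Fin m → Bool) (c : Fin m) : Prop :=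
  ∃ c', Matches l c c'

/-- `a` is a ray position of `l`: neither a good point of `l` nor the partner `c^∧` of a
good point `c` of `l`. -/
def RayPos (l : Fin m → Bool) (a : Fin m) : Prop :=
  ¬ IsGood l a ∧ ¬ ∃ c, Matches l c a

/-- `η` orients the diagram of `l`: `η(c) ≠ η(c^∧)` for every good point `c` of `l`, and
whenever `a < b` are ray positions of `l` with `η a = ∨`, also `η b = ∨`. -/
def Orients (η l : Fin m → Bool) : Prop :=
  (∀ c c', Matches l c c' → η c ≠ η c') ∧
    ∀ a b, RayPos l a → RayPos l b → a < b → η a = true → η b = true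

/-- The number of good points of `l`. -/
noncomputable def goodCount (l : Fin m → Bool) : ℕ :=
  (Finset.univ.filter (fun c => IsGood l c)).card

/-- The weight `w_l`: it takes the value `∨` exactly at the partners `c^∧` of the good
points `c` of `l` and at the `n − goodCount l` largest ray positions of `l` (a ray position
`a` is among the `k` largest ray positions iff fewer than `k` ray positions exceed it). -/
noncomputable def wMax (n : ℕ) (l : Fin m → Bool) : Fin m → Bool := fun a =>
  if (∃ c, Matches l c a) ∨
      (RayPos l a ∧
        (Finset.univ.filter (fun b => RayPos l b ∧ a < b)).card < n - goodCount l)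
  then true else false

/-- The Bruhat order on weights: `l ≤ μ` iff there is a bijection `f` from `l⁻¹(∨)` to
`μ⁻¹(∨)` with `x ≤ f x` for all `x`. -/
def BruhatLE (l μ : Fin m → Bool) : Prop :=
  ∃ f : {x : Fin m // l x = true} → {y : Fin m // μ y = true},
    Function.Bijective f ∧ ∀ x, x.1 ≤ (f x).1

end ArcAlgebra

open ArcAlgebra

namespace ArcAlgebra

variable {N : ℕ}

/-- The height of the lattice path of `l` before step `i`: every `∨` is an up-step and every
`∧` a down-step. -/
def height (l : Fin N → Bool) (i : ℕ) : ℤ :=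
  ∑ x : Fin N with x.val < i, if l x = true then 1 else -1

theorem height_succ (l : Fin N → Bool) (x : Fin N) :
    height l (x.val + 1) = height l x.val + if l x = true then 1 else -1 := by
  have h : Finset.univ.filter (fun y : Fin N => y.val < x.val + 1) =
      insert x (Finset.univ.filter (fun y : Fin N => y.val < x.val)) := by
    ext y
    simp only [Finset.mem_filter, Finset.mem_univ, true_and, Finset.mem_insert, Fin.ext_iff]
    omega
  rw [height, h, Finset.sum_insert (by simp), height, add_comm]

theorem height_succ_of_true {l : Fin N → Bool} {x : Fin N} (hx : l x = true) :
    height l (x.val + 1) = height l x.val + 1 := by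
  simp [height_succ, hx]

theorem height_succ_of_false {l : Fin N → Bool} {x : Fin N} (hx : l x = false) :
    height l (x.val + 1) = height l x.val - 1 := by
  simp [height_succ, hx, sub_eq_add_neg]

theorem height_succ_cases (l : Fin N → Bool) (x : Fin N) :
    (l x = true ∧ height l (x.val + 1) = height l x.val + 1) ∨
      (l x = false ∧ height l (x.val + 1) = height l x.val - 1) := by
  cases hx : l x
  · exact Or.inr ⟨rfl, height_succ_of_false hx⟩
  · exact Or.inl ⟨rfl, height_succ_of_true hx⟩

theorem balanced_iff_height {l : Fin N → Bool} {c d : Fin N} (h : c < d) :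
    Balanced l c d ↔ height l d.val = height l (c.val + 1) := by
  have hs : Finset.univ.filter (fun x : Fin N => x.val < d.val) =
      Finset.univ.filter (fun x : Fin N => x.val < c.val + 1) ∪
        Finset.univ.filter (fun x : Fin N => c < x ∧ x < d) := by
    ext y
    simp only [Finset.mem_filter, Finset.mem_univ, true_and, Finset.mem_union, Fin.lt_def] at h ⊢
    omega
  have hd : Disjoint (Finset.univ.filter (fun x : Fin N => x.val < c.val + 1))
      (Finset.univ.filter (fun x : Fin N => c < x ∧ x < d)) := by
    rw [Finset.disjoint_filter]
    intro x _ hx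
    simp only [Fin.lt_def]
    omega
  have key : height l d.val = height l (c.val + 1) +
      ((Finset.univ.filter (fun x => c < x ∧ x < d ∧ l x = true)).card -
        (Finset.univ.filter (fun x => c < x ∧ x < d ∧ l x = false)).card) := by
    rw [height, hs, Finset.sum_union hd, height,
      Finset.sum_ite (s := Finset.univ.filter (fun x => c < x ∧ x < d))]
    simp [Finset.filter_filter, and_assoc, sub_eq_add_neg]
  rw [Balanced, key]
  omega

theorem exists_first_return {l : Fin N → Bool} {c : Fin N} {i : ℕ} (hc : l c = true)
    (hci : c.val < i) (hi : i ≤ N) (h : height l i ≤ height l c.val) :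
    ∃ d : Fin N, c < d ∧ d.val + 1 ≤ i ∧ height l (d.val + 1) = height l c.val ∧
      ∀ k, c.val < k → k ≤ d.val → height l c.val < height l k := by
  have hex : ∃ k, c.val < k ∧ height l k ≤ height l c.val := ⟨i, hci, h⟩
  have hspec := Nat.find_spec hex
  have hmin : ∀ k, k < Nat.find hex → ¬ (c.val < k ∧ height l k ≤ height l c.val) :=
    fun k hk => Nat.find_min hex hk
  have hle : Nat.find hex ≤ i := Nat.find_min' hex ⟨hci, h⟩
  generalize Nat.find hex = q at *
  have h1 := height_succ_of_true hc
  have hq : q ≠ c.val + 1 := by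
    rintro rfl
    omega
  have hbefore : ∀ k, c.val < k → k ≤ q - 1 → height l c.val < height l k := by
    intro k hk hkq
    have := hmin k (by omega)
    by_contra hcon
    exact this ⟨hk, by omega⟩
  refine ⟨⟨q - 1, by omega⟩, ?_, ?_, ?_, hbefore⟩
  · rw [Fin.lt_def]
    change c.val < q - 1
    omega
  · change q - 1 + 1 ≤ i
    omega
  · have hlast := hbefore (q - 1) (by omega) le_rfl
    have hq1 : q - 1 + 1 = q := by omega
    have hstep := height_succ_cases l ⟨q - 1, by omega⟩
    simp only [hq1] at hstep ⊢
    omega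

theorem exists_last_visit {l : Fin N → Bool} {d : Fin N} {i : ℕ} (hd : l d = false)
    (hid : i ≤ d.val) (h : height l i ≤ height l (d.val + 1)) :
    ∃ c : Fin N, c < d ∧ i ≤ c.val ∧ height l (d.val + 1) = height l c.val ∧
      ∀ k, c.val < k → k ≤ d.val → height l c.val < height l k := by
  have hspec := Nat.findGreatest_spec (P := fun k => height l k ≤ height l (d.val + 1)) hid h
  have hle := Nat.le_findGreatest (P := fun k => height l k ≤ height l (d.val + 1)) hid h
  have hbd := Nat.findGreatest_le (P := fun k => height l k ≤ height l (d.val + 1)) d.val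
  have hmax : ∀ k, Nat.findGreatest (fun k => height l k ≤ height l (d.val + 1)) d.val < k →
      k ≤ d.val → ¬ height l k ≤ height l (d.val + 1) :=
    fun k h1 h2 => Nat.findGreatest_is_greatest h1 h2
  generalize Nat.findGreatest (fun k => height l k ≤ height l (d.val + 1)) d.val = q at *
  have h1 := height_succ_of_false hd
  have hq : q ≠ d.val := by
    rintro rfl
    omega
  have heq : height l q = height l (d.val + 1) := by
    have hstep := height_succ_cases l ⟨q, by omega⟩
    have := hmax (q + 1) (by omega) (by omega)
    simp only at hstep
    omega
  refine ⟨⟨q, by omega⟩, ?_, hle, heq.symm, ?_⟩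
  · rw [Fin.lt_def]
    change q < d.val
    omega
  · intro k hk hkd
    have := hmax k hk hkd
    change height l q < _
    omega

theorem matches_iff_height {l : Fin N → Bool} {c d : Fin N} :
    Matches l c d ↔ c < d ∧ height l (d.val + 1) = height l c.val ∧
      ∀ k, c.val < k → k ≤ d.val → height l c.val < height l k := by
  constructor
  · rintro ⟨hc, hcd, hd, hb, hmin⟩
    rw [balanced_iff_height hcd] at hb
    have h1 := height_succ_of_true hc
    have h2 := height_succ_of_false hd
    refine ⟨hcd, by omega, fun k hk hkd => ?_⟩
    by_contra hcon
    obtain ⟨e, hce, hek, he, hpos⟩ :=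
      exists_first_return hc hk (by omega) (not_lt.mp hcon)
    have h3 := hpos e.val hce le_rfl
    have hstep := height_succ_cases l e
    have hle : d ≤ e := hmin e hce (by rcases hstep with h | h <;> [omega; exact h.1])
      ((balanced_iff_height hce).2 (by omega))
    rw [Fin.le_def] at hle
    omega
  · rintro ⟨hcd, heq, hpos⟩
    have hcd' := Fin.lt_def.1 hcd
    have h1 := hpos (c.val + 1) (by omega) (by omega)
    have h2 := hpos d.val (by omega) le_rfl
    have hc := height_succ_cases l c
    have hd := height_succ_cases l d
    refine ⟨by rcases hc with h | h <;> [exact h.1; omega], hcd,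
      by rcases hd with h | h <;> [omega; exact h.1],
      (balanced_iff_height hcd).2 (by omega), fun e hce he hb => ?_⟩
    rw [balanced_iff_height hce] at hb
    have h3 := height_succ_of_false he
    by_contra hlt
    rw [Fin.le_def] at hlt
    have := hpos (e.val + 1) (by rw [Fin.lt_def] at hce; omega) (by omega)
    omega

theorem Matches.right_unique {l : Fin N → Bool} {c d d' : Fin N} (h : Matches l c d)
    (h' : Matches l c d') : d = d' :=
  le_antisymm (h.2.2.2.2 d' h'.2.1 h'.2.2.1 h'.2.2.2.1)
    (h'.2.2.2.2 d h.2.1 h.2.2.1 h.2.2.2.1)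

theorem Matches.left_unique {l : Fin N → Bool} {c c' d : Fin N} (h : Matches l c d)
    (h' : Matches l c' d) : c = c' := by
  obtain ⟨h1, h2, h3⟩ := matches_iff_height.1 h
  obtain ⟨h1', h2', h3'⟩ := matches_iff_height.1 h'
  rw [Fin.lt_def] at h1 h1'
  rcases lt_trichotomy c.val c'.val with hlt | heq | hgt
  · have := h3 c'.val hlt h1'.le
    omega
  · exact Fin.ext heq
  · have := h3' c.val hgt h1.le
    omega

theorem isGood_of_height_le {l : Fin N → Bool} {c : Fin N} {i : ℕ} (hc : l c = true)
    (hci : c.val < i) (hi : i ≤ N) (h : height l i ≤ height l c.val) : IsGood l c := by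
  obtain ⟨d, h1, -, h2, h3⟩ := exists_first_return hc hci hi h
  exact ⟨d, matches_iff_height.2 ⟨h1, h2, h3⟩⟩

theorem exists_matches_of_height_le {l : Fin N → Bool} {d : Fin N} {i : ℕ} (hd : l d = false)
    (hid : i ≤ d.val) (h : height l i ≤ height l (d.val + 1)) : ∃ c, Matches l c d := by
  obtain ⟨c, h1, -, h2, h3⟩ := exists_last_visit hd hid h
  exact ⟨c, matches_iff_height.2 ⟨h1, h2, h3⟩⟩

/-- Every weight orients its own diagram. -/
theorem orients_self (l : Fin N → Bool) : Orients l l := by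
  refine ⟨fun c d h => by simp [h.1, h.2.2.1], fun a b ha hb hab hla => ?_⟩
  by_contra hlb
  have hlb' : l b = false := by simpa using hlb
  rcases le_total (height l (b.val + 1)) (height l a.val) with h | h
  · exact ha.1 (isGood_of_height_le hla (by rw [Fin.lt_def] at hab; omega) (by omega) h)
  · exact hb.2 (exists_matches_of_height_le hlb' hab.le h)

theorem card_true_eq_goodCount_add {l ν : Fin N → Bool}
    (hν : ∀ c d, Matches l c d → ν c ≠ ν d) :
    (Finset.univ.filter (fun a => ν a = true)).card =
      goodCount l + (Finset.univ.filter (fun a => RayPos l a ∧ ν a = true)).card := by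
  have hex : ∀ c, ∃ d, IsGood l c → Matches l c d := fun c => by
    by_cases h : IsGood l c
    · exact ⟨h.choose, fun _ => h.choose_spec⟩
    · exact ⟨c, fun h' => absurd h' h⟩
  choose p hp using hex
  have hgood : goodCount l = (Finset.univ.filter (fun a => ¬ RayPos l a ∧ ν a = true)).card := by
    refine Finset.card_bij (fun c _ => if ν c = true then c else p c) ?_ ?_ ?_
    · intro c hc
      have hc' : IsGood l c := (Finset.mem_filter.1 hc).2
      have hne := hν _ _ (hp c hc')
      simp only [Finset.mem_filter, Finset.mem_univ, true_and]
      split_ifs with h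
      · exact ⟨fun hr => hr.1 hc', h⟩
      · exact ⟨fun hr => hr.2 ⟨c, hp c hc'⟩, by simpa [h] using hne⟩
    · intro c hc d hd heq
      have hc' := hp c (Finset.mem_filter.1 hc).2
      have hd' := hp d (Finset.mem_filter.1 hd).2
      split_ifs at heq with h1 h2 h2
      · exact heq
      · exact absurd hc'.1 (by rw [heq, hd'.2.2.1]; simp)
      · exact absurd hd'.1 (by rw [← heq, hc'.2.2.1]; simp)
      · rw [← heq] at hd'
        exact hc'.left_unique hd'
    · intro a ha
      obtain ⟨hr, ha⟩ := (Finset.mem_filter.1 ha).2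
      by_cases hg : IsGood l a
      · exact ⟨a, by simpa using hg, by simp [ha]⟩
      · have hpartner : ∃ c, Matches l c a := by
          by_contra h
          exact hr ⟨hg, h⟩
        obtain ⟨c, hc⟩ := hpartner
        have hgc : IsGood l c := ⟨a, hc⟩
        have hne := hν c a hc
        refine ⟨c, by simpa using hgc, ?_⟩
        have hcf : ¬ ν c = true := by rwa [ha] at hne
        simp only [hcf]
        exact (hp c hgc).right_unique hc
  rw [hgood, add_comm, ← Finset.card_filter_add_card_filter_not (fun a => RayPos l a),
    Finset.filter_filter, Finset.filter_filter]
  simp only [and_comm]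

theorem Orients.apply_ray_iff {k : ℕ} {l ν : Fin N → Bool} (hw : IsWeight k ν)
    (hν : Orients ν l) {a : Fin N} (ha : RayPos l a) :
    ν a = true ↔
      (Finset.univ.filter (fun b => RayPos l b ∧ a < b)).card < k - goodCount l := by
  have hcount := card_true_eq_goodCount_add hν.1
  rw [hw] at hcount
  have hk : k - goodCount l = (Finset.univ.filter (fun b => RayPos l b ∧ ν b = true)).card := by
    omega
  rw [hk]
  constructor
  · intro h
    refine Finset.card_lt_card (Finset.ssubset_iff_of_subset ?_ |>.2 ⟨a, ?_, ?_⟩)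
    · intro b hb
      simp only [Finset.mem_filter, Finset.mem_univ, true_and] at hb ⊢
      exact ⟨hb.1, hν.2 a b ha hb.1 hb.2 h⟩
    · simp [ha, h]
    · simp
  · intro hlt
    by_contra h
    refine absurd hlt (not_lt.2 (Finset.card_le_card fun b hb => ?_))
    simp only [Finset.mem_filter, Finset.mem_univ, true_and] at hb ⊢
    refine ⟨hb.1, lt_of_not_ge fun hba => h ?_⟩
    rcases hba.lt_or_eq with hba | rfl
    · exact hν.2 b a hb.1 ha hba hb.2
    · exact hb.2

/-- A weight orienting the diagram of `l` is above `l` in the Bruhat order. -/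
theorem Orients.bruhatLE {k : ℕ} {l ν : Fin N → Bool} (hl : IsWeight k l) (hw : IsWeight k ν)
    (hν : Orients ν l) : BruhatLE l ν := by
  have hray : ∀ a, RayPos l a → (ν a = true ↔ l a = true) := fun a ha =>
    (hν.apply_ray_iff hw ha).trans ((orients_self l).apply_ray_iff hl ha).symm
  have hgood : ∀ x, l x = true → ν x ≠ true → IsGood l x := fun x hx hνx => by
    by_contra hg
    refine hνx ((hray x ⟨hg, fun ⟨c, hc⟩ => ?_⟩).2 hx)
    simp [hc.2.2.1] at hx
  have hex : ∀ x : {x : Fin N // l x = true}, ∃ y : {y : Fin N // ν y = true},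
      (ν x.1 = true ∧ y.1 = x.1) ∨ (ν x.1 ≠ true ∧ Matches l x.1 y.1) := by
    rintro ⟨x, hx⟩
    by_cases h : ν x = true
    · exact ⟨⟨x, h⟩, Or.inl ⟨h, rfl⟩⟩
    · obtain ⟨y, hy⟩ := hgood x hx h
      exact ⟨⟨y, by simpa [h] using hν.1 x y hy⟩, Or.inr ⟨h, hy⟩⟩
  choose f hf using hex
  refine ⟨f, ⟨fun x x' heq => ?_, fun y => ?_⟩, fun x => ?_⟩
  · have h := hf x
    have h' := hf x'
    rw [← heq] at h'
    rcases h with ⟨-, h⟩ | ⟨-, h⟩ <;> rcases h' with ⟨-, h'⟩ | ⟨-, h'⟩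
    · exact Subtype.ext (h.symm.trans h')
    · exact absurd x.2 (by rw [← h, h'.2.2.1]; simp)
    · exact absurd x'.2 (by rw [← h', h.2.2.1]; simp)
    · exact Subtype.ext (h.left_unique h')
  · by_cases hy : l y.1 = true
    · refine ⟨⟨y.1, hy⟩, Subtype.ext ?_⟩
      rcases hf ⟨y.1, hy⟩ with h | h
      · exact h.2
      · exact absurd y.2 h.1
    · have hpartner : ∃ c, Matches l c y.1 := by
        by_contra h
        exact hy ((hray y.1 ⟨fun ⟨d, hd⟩ => hy hd.1, h⟩).1 y.2)
      obtain ⟨c, hc⟩ := hpartner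
      refine ⟨⟨c, hc.1⟩, Subtype.ext ?_⟩
      rcases hf ⟨c, hc.1⟩ with h | h
      · exact absurd (h.1.trans y.2.symm) (hν.1 c y.1 hc)
      · exact h.2.right_unique hc
  · rcases hf x with h | h
    · exact h.2.ge
    · exact h.2.2.1.le

/-- A weight that orients the diagram of `η` and is `∧` at all good points of `η` is `w_η`. -/
theorem Orients.eq_wMax {k : ℕ} {l η : Fin N → Bool} (hl : IsWeight k l) (ho : Orients l η)
    (h : ∀ c d, Matches η c d → l c = false) : l = wMax k η := by
  funext a
  rw [Bool.eq_iff_iff, wMax]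
  simp only [Bool.ite_eq_true_distrib, if_true_left, Bool.false_eq_true, imp_false, not_not]
  by_cases hp : ∃ c, Matches η c a
  · obtain ⟨c, hc⟩ := hp
    have := ho.1 c a hc
    rw [h c a hc] at this
    have ha : l a = true := by simpa using this.symm
    simp only [ha, true_iff]
    exact Or.inl ⟨c, hc⟩
  · by_cases hg : IsGood η a
    · obtain ⟨d, hd⟩ := hg
      simp only [h a d hd, Bool.false_eq_true, false_iff]
      rintro (h' | h')
      · exact hp h'
      · exact h'.1.1 ⟨d, hd⟩
    · have hr : RayPos η a := ⟨hg, hp⟩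
      rw [ho.apply_ray_iff hl hr]
      simp [hp, hr]

theorem Matches.exists_inner {l : Fin N → Bool} {c d x : Fin N} (h : Matches l c d)
    (hcx : c < x) (hxd : x < d) :
    (∃ y, Matches l x y ∧ y < d) ∨ (∃ y, Matches l y x ∧ c < y) := by
  obtain ⟨-, heq, hpos⟩ := matches_iff_height.1 h
  rw [Fin.lt_def] at hcx hxd
  have h1 := hpos x.val hcx hxd.le
  have h2 := hpos (x.val + 1) (by omega) (by omega)
  rcases height_succ_cases l x with ⟨hx, -⟩ | ⟨hx, -⟩
  · obtain ⟨y, hxy, hy, hey, hpy⟩ :=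
      exists_first_return (i := d.val + 1) hx (by omega) (by omega) (by omega)
    refine Or.inl ⟨y, matches_iff_height.2 ⟨hxy, hey, hpy⟩, ?_⟩
    rw [Fin.lt_def]
    by_contra hcon
    have : y.val = d.val := by omega
    rw [this] at hey
    omega
  · obtain ⟨y, hyx, hy, hey, hpy⟩ := exists_last_visit (i := c.val) hx hcx.le (by omega)
    refine Or.inr ⟨y, matches_iff_height.2 ⟨hyx, hey, hpy⟩, ?_⟩
    rw [Fin.lt_def]
    by_contra hcon
    have : y.val = c.val := by omega
    rw [this] at hey
    omega

/-- The steps of `l` in the interval `[c, d]` joining the levels `height l c` and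
`height l c + 1`. -/
def BottomStep (l : Fin N → Bool) (c d x : Fin N) : Prop :=
  c ≤ x ∧ x ≤ d ∧
    ((height l x.val = height l c.val ∧ height l (x.val + 1) = height l c.val + 1) ∨
      (height l x.val = height l c.val + 1 ∧ height l (x.val + 1) = height l c.val))

theorem not_rayPos_of_bottomStep {l : Fin N → Bool} {c d x : Fin N}
    (hcd : height l (d.val + 1) = height l c.val) (hx : BottomStep l c d x) : ¬ RayPos l x := by
  rintro ⟨hg, hp⟩
  obtain ⟨hcx, hxd, h⟩ := hx
  rw [Fin.le_def] at hcx hxd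
  rcases height_succ_cases l x with ⟨hx, hs⟩ | ⟨hx, hs⟩
  · exact hg (isGood_of_height_le (i := d.val + 1) hx (by omega) (by omega) (by omega))
  · exact hp (exists_matches_of_height_le hx hcx (by omega))

theorem Matches.bottomStep_iff {l : Fin N → Bool} {c d a b : Fin N}
    (hcd : height l (d.val + 1) = height l c.val) (h : Matches l a b) :
    BottomStep l c d a ↔ BottomStep l c d b := by
  have ha := height_succ_of_true h.1
  have hb := height_succ_of_false h.2.2.1
  obtain ⟨hab, heq, hpos⟩ := matches_iff_height.1 h
  simp only [BottomStep, Fin.le_def, Fin.lt_def] at *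
  constructor
  · rintro ⟨h1, h2, h3⟩
    refine ⟨by omega, ?_, by omega⟩
    by_contra hcon
    have := hpos (d.val + 1) (by omega) (by omega)
    omega
  · rintro ⟨h1, h2, h3⟩
    refine ⟨?_, by omega, by omega⟩
    by_contra hcon
    have := hpos c.val (by omega) (by omega)
    omega

/-- If `l` is opposite to `η` strictly inside the cup `(c, d)` of `η`, then its height there is
the mirror image of that of `η`. -/
theorem height_add_height_eq {l η : Fin N → Bool} {c d : Fin N} (hηc : η c = true)
    (hlc : l c = true) (h : ∀ x, c < x → x < d → l x ≠ η x) {i : ℕ} (hci : c.val < i)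
    (hid : i ≤ d.val) : height l i + height η i = height l c.val + height η c.val + 2 := by
  induction i, hci using Nat.le_induction with
  | base =>
    rw [Nat.succ_eq_add_one, height_succ_of_true hlc, height_succ_of_true hηc]
    ring
  | succ i hi ih =>
    have hne := h ⟨i, by omega⟩ (Fin.lt_def.2 hi) (Fin.lt_def.2 (by simpa using hid))
    have h1 := height_succ_cases l ⟨i, by omega⟩
    have h2 := height_succ_cases η ⟨i, by omega⟩
    have h3 := ih (by omega)
    simp only at h1 h2
    rcases h1 with h1 | h1 <;> rcases h2 with h2 | h2
    · exact absurd (h1.1.trans h2.1.symm) hne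
    · omega
    · omega
    · exact absurd (h1.1.trans h2.1.symm) hne

theorem Orients.exists_innermost {l η : Fin N → Bool} (ho : Orients l η)
    (h : ∃ c d, Matches η c d ∧ l c = true) :
    ∃ c d, Matches η c d ∧ l c = true ∧ ∀ x, c < x → x < d → l x ≠ η x := by
  have hex : ∃ k, ∃ c d : Fin N, Matches η c d ∧ l c = true ∧ d.val - c.val = k := by
    obtain ⟨c, d, h1, h2⟩ := h
    exact ⟨_, c, d, h1, h2, rfl⟩
  obtain ⟨c, d, hm, hlc, hk⟩ := Nat.find_spec hex
  have hinner : ∀ a b, c < a → b < d → Matches η a b → l a = false := by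
    intro a b hca hbd hab
    by_contra hcon
    have hlt := hab.2.1
    rw [Fin.lt_def] at hca hbd hlt
    exact Nat.find_min hex (m := b.val - a.val) (by omega) ⟨a, b, hab, by simpa using hcon, rfl⟩
  refine ⟨c, d, hm, hlc, fun x hcx hxd => ?_⟩
  rcases hm.exists_inner hcx hxd with ⟨y, hy, hyd⟩ | ⟨y, hy, hcy⟩
  · rw [hinner x y hcx hyd hy, hy.1]
    simp
  · have := ho.1 y x hy
    rw [hinner y x hcy hxd hy] at this
    rw [hy.2.2.1]
    exact this.symm

theorem Orients.exists_flip {k : ℕ} {l η : Fin N → Bool} (hl : IsWeight k l)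
    (ho : Orients l η) (h : l ≠ wMax k η) :
    ∃ l', IsWeight k l' ∧ l ≠ l' ∧ Orients l' l ∧ Orients l' η := by
  have hcup : ∃ c d, Matches η c d ∧ l c = true := by
    by_contra hcon
    push Not at hcon
    exact h (ho.eq_wMax hl fun c d hcd => by simpa using hcon c d hcd)
  obtain ⟨c, d, hm, hlc, hopp⟩ := ho.exists_innermost hcup
  have hld : l d = false := by simpa [hlc] using (ho.1 c d hm).symm
  have hmirror : ∀ i, c.val < i → i ≤ d.val →
      height l i + height η i = height l c.val + height η c.val + 2 :=
    fun i => height_add_height_eq hm.1 hlc hopp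
  have hcd : c.val < d.val := hm.2.1
  have hη := (matches_iff_height.1 hm).2
  have hlc1 := height_succ_of_true hlc
  have hld1 := height_succ_of_false hld
  have hηd1 := height_succ_of_false hm.2.2.1
  have hmd := hmirror d.val hcd le_rfl
  have hend : height l (d.val + 1) = height l c.val := by omega
  have hSc : BottomStep l c d c := ⟨le_rfl, hm.2.1.le, by omega⟩
  have hSd : BottomStep l c d d := ⟨hm.2.1.le, le_rfl, by omega⟩
  have hSl : ∀ a b, Matches l a b → (BottomStep l c d a ↔ BottomStep l c d b) :=
    fun a b hab => hab.bottomStep_iff hend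
  have hSη : ∀ a b, Matches η a b → (BottomStep l c d a ↔ BottomStep l c d b) := by
    have hinside : ∀ a b, Matches η a b → c < a → b < d →
        (BottomStep l c d a ↔ BottomStep l c d b) := by
      intro a b hab hca hbd
      have hlt := hab.2.1
      have h1 := height_succ_of_true hab.1
      have h2 := height_succ_of_false hab.2.2.1
      have h3 := (matches_iff_height.1 hab).2.1
      simp only [BottomStep, Fin.le_def, Fin.lt_def] at *
      have m1 := hmirror a.val (by omega) (by omega)
      have m2 := hmirror (a.val + 1) (by omega) (by omega)
      have m3 := hmirror b.val (by omega) (by omega)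
      have m4 := hmirror (b.val + 1) (by omega) (by omega)
      omega
    intro a b hab
    constructor
    · intro ha
      rcases ha.1.lt_or_eq with hca | rfl
      · rcases ha.2.1.lt_or_eq with had | rfl
        · rcases hm.exists_inner hca had with ⟨y, hy, hyd⟩ | ⟨y, hy, -⟩
          · rw [hy.right_unique hab] at hyd
            exact (hinside a b hab hca hyd).1 ha
          · simpa [hab.1] using hy.2.2.1
        · simpa [hab.1] using hm.2.2.1
      · rwa [hab.right_unique hm]
    · intro hb
      rcases hb.2.1.lt_or_eq with hbd | rfl
      · rcases hb.1.lt_or_eq with hcb | rfl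
        · rcases hm.exists_inner hcb hbd with ⟨y, hy, -⟩ | ⟨y, hy, hcy⟩
          · simpa [hab.2.2.1] using hy.1
          · rw [hy.left_unique hab] at hcy
            exact (hinside a b hab hcy hbd).2 hb
        · simpa [hab.2.2.1] using hm.1
      · rwa [hab.left_unique hm]
  have hrayl : ∀ a, RayPos l a → ¬ BottomStep l c d a :=
    fun a ha hS => not_rayPos_of_bottomStep hend hS ha
  have hrayη : ∀ a, RayPos η a → ¬ BottomStep l c d a := by
    intro a ha hS
    rcases hS.1.lt_or_eq with hca | rfl
    · rcases hS.2.1.lt_or_eq with had | rfl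
      · rcases hm.exists_inner hca had with ⟨y, hy, -⟩ | ⟨y, hy, -⟩
        · exact ha.1 ⟨y, hy⟩
        · exact ha.2 ⟨y, hy⟩
      · exact ha.2 ⟨c, hm⟩
    · exact ha.1 ⟨d, hm⟩
  let l' : Fin N → Bool := fun x => if BottomStep l c d x then !(l x) else l x
  have horient : ∀ κ : Fin N → Bool, Orients l κ →
      (∀ a b, Matches κ a b → (BottomStep l c d a ↔ BottomStep l c d b)) →
      (∀ a, RayPos κ a → ¬ BottomStep l c d a) → Orients l' κ := by
    intro κ hκ hcups hrays
    refine ⟨fun a b hab => ?_, fun a b ha hb hab hla => ?_⟩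
    · have := hκ.1 a b hab
      by_cases hS : BottomStep l c d b
      · simpa [l', hcups a b hab, hS] using this
      · simpa [l', hcups a b hab, hS] using this
    · simp only [l', hrays a ha, hrays b hb, if_false] at hla ⊢
      exact hκ.2 a b ha hb hab hla
  have hl'l := horient l (orients_self l) hSl hrayl
  refine ⟨l', ?_, fun heq => ?_, hl'l, horient η ho hSη hrayη⟩
  · rw [IsWeight, card_true_eq_goodCount_add hl'l.1, ← hl,
      card_true_eq_goodCount_add (orients_self l).1]
    congr 2
    ext a
    simp only [Finset.mem_filter, Finset.mem_univ, true_and]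
    refine and_congr_right fun ha => ?_
    simp [l', hrayl a ha]
  · have := congrFun heq c
    simp [l', hSc] at this

/-- Unless `l = w_η`, an orientable circle diagram `\underline{l}\overline{η}` has an orientation
strictly above `l`. -/
theorem exists_orients_gt {k : ℕ} {l η ν : Fin N → Bool} (hl : IsWeight k l)
    (hw : IsWeight k ν) (hνl : Orients ν l) (hνη : Orients ν η) (h : l ≠ wMax k η) :
    ∃ l', IsWeight k l' ∧ BruhatLE l l' ∧ l ≠ l' ∧ Orients l' l ∧ Orients l' η := by
  by_cases heq : l = ν
  · subst heq
    obtain ⟨l', h1, h2, h3, h4⟩ := hνη.exists_flip hl h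
    exact ⟨l', h1, h3.bruhatLE hl h1, h2, h3, h4⟩
  · exact ⟨ν, hw, hνl.bruhatLE hl hw, heq, hνl, hνη⟩

end ArcAlgebra

/-- Let `0 ≤ j ≤ n ≤ m` with `n − j ≤ m − n`.  Let `le₁` be a linear
order on `Λ_{j,n}` refining the Bruhat order and `le₂` a linear order on `Λ_{n−j,m−n}`
refining the Bruhat order, and order pairs lexicographically:
`(λ,μ) <ᵀ (λ',μ')` iff `λ <₁ᵀ λ'`, or `λ = λ'` and `μ <₂ᵀ μ'` (where `a <ᵀ b` abbreviates
`le a b ∧ a ≠ b`).  Suppose `λ, η₁ ∈ Λ_{j,n}` and `μ, η₂ ∈ Λ_{n−j,m−n}` satisfy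
`(w_{η₁}, w_{η₂}) >ᵀ (λ, μ) >ᵀ (η₁, η₂)`.  If there exist `ν₁ ∈ Λ_{j,n}` with
`\underline{λ}ν₁\overline{η₁}` oriented and `ν₂ ∈ Λ_{n−j,m−n}` with
`\underline{μ}ν₂\overline{η₂}` oriented, then there exists a pair `(λ', μ') >ᵀ (λ, μ)`
such that both `\underline{λ}λ'\overline{η₁}` and `\underline{μ}μ'\overline{η₂}` are
oriented circle diagrams. -/
theorem statement14 (j n m : ℕ) (hj : j ≤ n) (hnm : n ≤ m) (hbal : n - j ≤ m - n)
    (le₁ : (Fin n → Bool) → (Fin n → Bool) → Prop)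
    (le₂ : (Fin (m - n) → Bool) → (Fin (m - n) → Bool) → Prop)
    (href₁ : ∀ a b, IsWeight j a → IsWeight j b → BruhatLE a b → le₁ a b)
    (htot₁ : ∀ a b, IsWeight j a → IsWeight j b → le₁ a b ∨ le₁ b a)
    (hanti₁ : ∀ a b, IsWeight j a → IsWeight j b → le₁ a b → le₁ b a → a = b)
    (htr₁ : ∀ a b c, IsWeight j a → IsWeight j b → IsWeight j c →
      le₁ a b → le₁ b c → le₁ a c)
    (href₂ : ∀ a b, IsWeight (n - j) a → IsWeight (n - j) b → BruhatLE a b → le₂ a b)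
    (htot₂ : ∀ a b, IsWeight (n - j) a → IsWeight (n - j) b → le₂ a b ∨ le₂ b a)
    (hanti₂ : ∀ a b, IsWeight (n - j) a → IsWeight (n - j) b → le₂ a b → le₂ b a → a = b)
    (htr₂ : ∀ a b c, IsWeight (n - j) a → IsWeight (n - j) b → IsWeight (n - j) c →
      le₂ a b → le₂ b c → le₂ a c)
    (lam η₁ : Fin n → Bool) (mu η₂ : Fin (m - n) → Bool)
    (hlam : IsWeight j lam) (hη₁ : IsWeight j η₁)
    (hmu : IsWeight (n - j) mu) (hη₂ : IsWeight (n - j) η₂)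
    (hUp : (le₁ lam (wMax j η₁) ∧ lam ≠ wMax j η₁) ∨
      (lam = wMax j η₁ ∧ le₂ mu (wMax (n - j) η₂) ∧ mu ≠ wMax (n - j) η₂))
    (hDown : (le₁ η₁ lam ∧ η₁ ≠ lam) ∨ (η₁ = lam ∧ le₂ η₂ mu ∧ η₂ ≠ mu))
    (ν₁ : Fin n → Bool) (hν₁w : IsWeight j ν₁)
    (hν₁ : Orients ν₁ lam ∧ Orients ν₁ η₁)
    (ν₂ : Fin (m - n) → Bool) (hν₂w : IsWeight (n - j) ν₂)
    (hν₂ : Orients ν₂ mu ∧ Orients ν₂ η₂) :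
    ∃ (lam' : Fin n → Bool) (mu' : Fin (m - n) → Bool),
      IsWeight j lam' ∧ IsWeight (n - j) mu' ∧
      ((le₁ lam lam' ∧ lam ≠ lam') ∨ (lam = lam' ∧ le₂ mu mu' ∧ mu ≠ mu')) ∧
      Orients lam' lam ∧ Orients lam' η₁ ∧ Orients mu' mu ∧ Orients mu' η₂ := by
  by_cases h₁ : lam = wMax j η₁
  · have h₂ : mu ≠ wMax (n - j) η₂ := by
      rcases hUp with h | h
      · exact absurd h₁ h.2
      · exact h.2.2
    obtain ⟨mu', hw, hle, hne, ho, ho'⟩ := exists_orients_gt hmu hν₂w hν₂.1 hν₂.2 h₂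
    by_cases heq : lam = ν₁
    · exact ⟨ν₁, mu', hν₁w, hw, Or.inr ⟨heq, href₂ _ _ hmu hw hle, hne⟩,
        hν₁.1, hν₁.2, ho, ho'⟩
    · exact ⟨ν₁, mu', hν₁w, hw,
        Or.inl ⟨href₁ _ _ hlam hν₁w (hν₁.1.bruhatLE hlam hν₁w), heq⟩,
        hν₁.1, hν₁.2, ho, ho'⟩
  · obtain ⟨lam', hw, hle, hne, ho, ho'⟩ := exists_orients_gt hlam hν₁w hν₁.1 hν₁.2 h₁
    exact ⟨lam', ν₂, hw, hν₂w, Or.inl ⟨href₁ _ _ hlam hw hle, hne⟩,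
      ho, ho', hν₂.1, hν₂.2⟩
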